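/- If X, Y ∈ 𝔤 are orthonormal with respect to ⟨·,·⟩₁, then X^c and Y^c are orthonormal with respect to g̃ and the sectional curvature satisfies K̃(X^c, Y^c) = g̃(R̃(X^c,Y^c)Y^c, X^c) = ⟨R¹(X,Y)Y, X⟩₁ = K¹(X,Y). -/

import Mathlib

/-- `g` is an inner product (symmetric positive-definite bilinear form) on a real vector space. -/
structure IsInnerProd {L : Type*} [AddCommGroup L] [Module ℝ L] (g : L → L → ℝ) : Prop where
  addLeft : ∀ x y z : L, g (x + y) z = g x z + g y z
  smulLeft : ∀ (a : ℝ) (x y : L), g (a • x) y = a * g x y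
  symm : ∀ x y : L, g x y = g y x
  posDef : ∀ x : L, x ≠ 0 → 0 < g x x

/-- The bracket of the tangent Lie algebra `T𝔤 = 𝔤 × 𝔤`:
`[(X₁,Y₁),(X₂,Y₂)] = ([X₁,X₂], [X₁,Y₂] + [Y₁,X₂])`.
The complete lift of `X` is `(X, 0)` and the vertical lift is `(0, X)`. -/
def tbr {L : Type*} [LieRing L] (A B : L × L) : L × L :=
  (⁅A.1, B.1⁆, ⁅A.1, B.2⁆ + ⁅A.2, B.1⁆)

/-- The lifted inner product `g̃` on `T𝔤 = 𝔤 × 𝔤` determined by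
`g̃(X^c,Y^c) = ⟨X,Y⟩₁`, `g̃(X^v,Y^v) = ⟨X,Y⟩₂`, `g̃(X^c,Y^v) = 0`. -/
def tg {L : Type*} (g1 g2 : L → L → ℝ) (A B : L × L) : ℝ :=
  g1 A.1 B.1 + g2 A.2 B.2

/-- `nab` is the Levi-Civita connection of the metric `g` with respect to the bracket `br`,
i.e. it satisfies the Koszul formula
`2⟨∇_X Y, Z⟩ = ⟨[X,Y],Z⟩ − ⟨[Y,Z],X⟩ + ⟨[Z,X],Y⟩`. -/
def IsLC {V : Type*} [AddCommGroup V] [Module ℝ V] (br : V → V → V)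
    (g : V → V → ℝ) (nab : V → V → V) : Prop :=
  ∀ X Y Z : V, 2 * g (nab X Y) Z = g (br X Y) Z - g (br Y Z) X + g (br Z X) Y

/-- The curvature tensor `R(X,Y)Z = ∇_X ∇_Y Z − ∇_Y ∇_X Z − ∇_{[X,Y]} Z`. -/
def curvOf {V : Type*} [AddCommGroup V] (br nab : V → V → V) (X Y Z : V) : V :=
  nab X (nab Y Z) - nab Y (nab X Z) - nab (br X Y) Z

namespace IsInnerProd

variable {L : Type*} [AddCommGroup L] [Module ℝ L] {g : L → L → ℝ}

theorem zero_left (hg : IsInnerProd g) (x : L) : g 0 x = 0 := by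
  simpa using hg.smulLeft 0 0 x

theorem zero_right (hg : IsInnerProd g) (x : L) : g x 0 = 0 := by
  rw [hg.symm, hg.zero_left]

theorem sub_left (hg : IsInnerProd g) (x y z : L) : g (x - y) z = g x z - g y z := by
  have h := hg.addLeft (x - y) y z
  rw [sub_add_cancel] at h
  linarith

/-- An inner product is nondegenerate. -/
theorem eq_of_forall_left (hg : IsInnerProd g) {x y : L} (h : ∀ z, g x z = g y z) : x = y := by
  by_contra hne
  have hpos := hg.posDef (x - y) (sub_ne_zero.2 hne)
  rw [hg.sub_left, h, sub_self] at hpos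
  exact lt_irrefl 0 hpos

theorem self_nonneg (hg : IsInnerProd g) (x : L) : 0 ≤ g x x := by
  rcases eq_or_ne x 0 with rfl | hx
  · rw [hg.zero_left]
  · exact (hg.posDef x hx).le

/-- The lifted form on `L × L` is an inner product. -/
theorem tg {g1 g2 : L → L → ℝ} (hg1 : IsInnerProd g1) (hg2 : IsInnerProd g2) :
    IsInnerProd (tg g1 g2) where
  addLeft x y z := by
    simp only [_root_.tg, Prod.fst_add, Prod.snd_add, hg1.addLeft, hg2.addLeft]
    ring
  smulLeft a x y := by
    simp only [_root_.tg, Prod.smul_fst, Prod.smul_snd, hg1.smulLeft, hg2.smulLeft]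
    ring
  symm x y := by
    simp only [_root_.tg, hg1.symm x.1, hg2.symm x.2]
  posDef x hx := by
    by_cases h : x.1 = 0
    · have h2 : x.2 ≠ 0 := fun h2 => hx (Prod.ext h h2)
      exact add_pos_of_nonneg_of_pos (hg1.self_nonneg _) (hg2.posDef _ h2)
    · exact add_pos_of_pos_of_nonneg (hg1.posDef _ h) (hg2.self_nonneg _)

end IsInnerProd

/-- The Levi-Civita connection of the lifted metric maps complete lifts to complete lifts. -/
theorem IsLC.complete_lift {L : Type*} [LieRing L] [Module ℝ L] {g1 g2 : L → L → ℝ}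
    (hg1 : IsInnerProd g1) (hg2 : IsInnerProd g2) {nab : L → L → L}
    (hn : IsLC (fun X Y : L => ⁅X, Y⁆) g1 nab) {tnab : L × L → L × L → L × L}
    (htn : IsLC tbr (tg g1 g2) tnab) (X Y : L) :
    tnab (X, 0) (Y, 0) = (nab X Y, 0) := by
  refine (hg1.tg hg2).eq_of_forall_left fun Z => ?_
  have h1 := hn X Y Z.1
  have h2 := htn (X, 0) (Y, 0) Z
  simp only [tg, tbr, lie_zero, zero_lie, add_zero, hg2.zero_left, hg2.zero_right] at h1 h2 ⊢
  linarith

theorem statement14 {L : Type*} [LieRing L] [Module ℝ L] [LieAlgebra ℝ L]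
    [FiniteDimensional ℝ L]
    (g1 g2 : L → L → ℝ) (hg1 : IsInnerProd g1) (hg2 : IsInnerProd g2)
    (nabla1 nabla2 : L → L → L)
    (hn1 : IsLC (fun X Y : L => ⁅X, Y⁆) g1 nabla1)
    (hn2 : IsLC (fun X Y : L => ⁅X, Y⁆) g2 nabla2)
    (tnabla : L × L → L × L → L × L)
    (htn : IsLC tbr (tg g1 g2) tnabla)
    (X Y : L) (hXX : g1 X X = 1) (hYY : g1 Y Y = 1) (hXY : g1 X Y = 0) :
    (tg g1 g2 (X, 0) (X, 0) = 1 ∧ tg g1 g2 (Y, 0) (Y, 0) = 1 ∧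
      tg g1 g2 (X, 0) (Y, 0) = 0) ∧
    tg g1 g2 (curvOf tbr tnabla (X, 0) (Y, 0) (Y, 0)) (X, 0)
      = g1 (curvOf (fun X Y : L => ⁅X, Y⁆) nabla1 X Y Y) X := by
  have hc := IsLC.complete_lift hg1 hg2 hn1 htn
  refine ⟨by simp [tg, hg2.zero_left, hXX, hYY, hXY], ?_⟩
  simp only [curvOf, tbr, lie_zero, zero_lie, add_zero, hc, tg, Prod.fst_sub, Prod.snd_sub,
    sub_self, hg2.zero_left]
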